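/- Let f¹, f², f³ : {-1,+1}^m → {0,1} be increasing functions. Then |Σ_{S ⊆ {1,…,m}, S ≠ ∅} f̂¹_S f̂²_S f̂³_S| ≤ max_{i ∈ {1,…,m}} f̂¹_{{i}}; equivalently, the left-hand side is bounded by the maximum over coordinates i of the probability (under the uniform measure on {-1,+1}^m) that i is pivotal for f¹. -/

import Mathlib

open Finset MeasureTheory ProbabilityTheory
open scoped symmDiff

/-- The two-element set `{-1, +1}` of real numbers.  Points of the discrete cube
`{-1,+1}^m` are modelled as functions `Fin m → SignSet`. -/
noncomputable def SignSet : Finset ℝ := {-1, 1}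

instance : Nonempty SignSet := ⟨⟨1, by simp [SignSet]⟩⟩

/-- The element `+1` of `{-1,+1}`. -/
noncomputable def sOne : SignSet := ⟨1, by simp [SignSet]⟩

/-- The element `-1` of `{-1,+1}`. -/
noncomputable def sNegOne : SignSet := ⟨-1, by simp [SignSet]⟩

lemma mul_mem_SignSet {a b : ℝ} (ha : a ∈ SignSet) (hb : b ∈ SignSet) :
    a * b ∈ SignSet := by
  simp only [SignSet, Finset.mem_insert, Finset.mem_singleton] at *
  rcases ha with h | h <;> rcases hb with h' | h' <;> norm_num [h, h']

/-- Coordinatewise product `x·y = (x₁y₁, …, x_m y_m)` of two points of `{-1,+1}^m`. -/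
noncomputable def pmul {m : ℕ} (x y : Fin m → SignSet) : Fin m → SignSet :=
  fun i => ⟨(x i : ℝ) * (y i : ℝ), mul_mem_SignSet (x i).2 (y i).2⟩

/-- Expectation of `f : {-1,+1}^m → ℝ` with respect to the uniform probability
measure `P(B) = |B| / 2^m` on `{-1,+1}^m`. -/
noncomputable def expect {m : ℕ} (f : (Fin m → SignSet) → ℝ) : ℝ :=
  (∑ x : Fin m → SignSet, f x) / 2 ^ m

/-- Expectation of a function on `{-1,+1}^m × {-1,+1}^m` with respect to the uniform
probability measure `P(B) = |B| / 4^m`. -/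
noncomputable def expect2 {m : ℕ} (f : (Fin m → SignSet) × (Fin m → SignSet) → ℝ) : ℝ :=
  (∑ p : (Fin m → SignSet) × (Fin m → SignSet), f p) / 4 ^ m

/-- The uniform probability measure on `{-1,+1}^m`. -/
noncomputable def unifMeasure (m : ℕ) : Measure (Fin m → SignSet) :=
  (PMF.uniformOfFintype (Fin m → SignSet)).toMeasure

/-- The uniform probability measure on `{-1,+1}^m × {-1,+1}^m`. -/
noncomputable def unifMeasure2 (m : ℕ) : Measure ((Fin m → SignSet) × (Fin m → SignSet)) :=
  (PMF.uniformOfFintype ((Fin m → SignSet) × (Fin m → SignSet))).toMeasure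

lemma ss_cases (a : SignSet) : (a : ℝ) = -1 ∨ (a : ℝ) = 1 := by
  have := a.2
  simpa [SignSet] using this

lemma ss_sum (g : ℝ → ℝ) : ∑ a : SignSet, g (a : ℝ) = g (-1) + g 1 := by
  rw [Finset.sum_coe_sort SignSet g, SignSet, Finset.sum_pair (by norm_num)]

lemma chi_orth {m : ℕ} (S T : Finset (Fin m)) :
    ∑ x : Fin m → SignSet, (∏ i ∈ S, (x i : ℝ)) * (∏ i ∈ T, (x i : ℝ)) =
      if S = T then 2 ^ m else 0 := by
  have h1 : ∀ x : Fin m → SignSet, (∏ i ∈ S, (x i : ℝ)) * (∏ i ∈ T, (x i : ℝ)) =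
      ∏ i, ((if i ∈ S then (x i : ℝ) else 1) * (if i ∈ T then (x i : ℝ) else 1)) := by
    intro x
    rw [Finset.prod_mul_distrib, Finset.prod_ite_mem, Finset.prod_ite_mem]
    simp
  simp_rw [h1]
  have h2 := Finset.prod_univ_sum (fun _ : Fin m => (Finset.univ : Finset SignSet))
    (fun i a => ((if i ∈ S then (a : ℝ) else 1) * (if i ∈ T then (a : ℝ) else 1)))
  rw [Fintype.piFinset_univ] at h2
  rw [← h2]
  have h3 : ∀ i, ∑ a : SignSet, ((if i ∈ S then (a : ℝ) else 1) * (if i ∈ T then (a : ℝ) else 1))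
      = if (i ∈ S ↔ i ∈ T) then 2 else 0 := by
    intro i
    rw [ss_sum (fun a => ((if i ∈ S then a else 1) * (if i ∈ T then a else 1)))]
    by_cases hS : i ∈ S <;> by_cases hT : i ∈ T <;> simp [hS, hT] <;> norm_num
  simp_rw [h3]
  split_ifs with h
  · subst h; simp
  · have : ∃ i, ¬ (i ∈ S ↔ i ∈ T) := by
      by_contra hcon
      push Not at hcon
      exact h (Finset.ext hcon)
    obtain ⟨i, hi⟩ := this
    exact Finset.prod_eq_zero (Finset.mem_univ i) (if_neg hi)

lemma coef_eq {m : ℕ} (f : (Fin m → SignSet) → ℝ) (c : Finset (Fin m) → ℝ)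
    (hc : ∀ x : Fin m → SignSet, f x = ∑ S : Finset (Fin m), c S * ∏ i ∈ S, (x i : ℝ))
    (T : Finset (Fin m)) : ∑ x, f x * ∏ i ∈ T, (x i : ℝ) = 2 ^ m * c T := by
  simp_rw [hc, Finset.sum_mul]
  rw [Finset.sum_comm]
  simp_rw [mul_assoc, ← Finset.mul_sum, chi_orth]
  simp [mul_comm]

lemma parseval_le {m : ℕ} (f : (Fin m → SignSet) → ℝ) (c : Finset (Fin m) → ℝ)
    (h01 : ∀ x, f x = 0 ∨ f x = 1)
    (hc : ∀ x : Fin m → SignSet, f x = ∑ S : Finset (Fin m), c S * ∏ i ∈ S, (x i : ℝ)) :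
    ∑ S, c S ^ 2 ≤ 1 := by
  have h1 : ∑ x, f x * f x = 2 ^ m * ∑ S, c S ^ 2 := by
    have : ∀ x, f x * f x = ∑ S, c S * (f x * ∏ i ∈ S, (x i : ℝ)) := by
      intro x
      conv_lhs => rw [hc x]
      rw [Finset.sum_mul, ← hc x]
      exact Finset.sum_congr rfl fun _ _ => by ring
    simp_rw [this]
    rw [Finset.sum_comm]
    simp_rw [← Finset.mul_sum, coef_eq f c hc]
    rw [Finset.mul_sum]
    exact Finset.sum_congr rfl fun _ _ => by ring
  have h2 : ∑ x, f x * f x ≤ ∑ _x : Fin m → SignSet, (1 : ℝ) :=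
    Finset.sum_le_sum fun x _ => by rcases h01 x with h | h <;> simp [h]
  have h3 : ∑ _x : Fin m → SignSet, (1 : ℝ) = 2 ^ m := by
    simpa using chi_orth (∅ : Finset (Fin m)) ∅
  have h4 : (0 : ℝ) < 2 ^ m := by positivity
  rw [h1, h3] at h2
  nlinarith

noncomputable def sneg (a : SignSet) : SignSet := ⟨-(a : ℝ), by
  rcases ss_cases a with h | h <;> simp [SignSet, h]⟩

noncomputable def sflip {m : ℕ} (i : Fin m) (x : Fin m → SignSet) : Fin m → SignSet :=
  Function.update x i (sneg (x i))

lemma sflip_invol {m : ℕ} (i : Fin m) : Function.Involutive (sflip i) := by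
  intro x
  simp [sflip, sneg]

lemma chi_flip {m : ℕ} (i : Fin m) (S : Finset (Fin m)) (hi : i ∈ S) (x : Fin m → SignSet) :
    ∏ j ∈ S, (sflip i x j : ℝ) = - ∏ j ∈ S, (x j : ℝ) := by
  rw [← Finset.mul_prod_erase S _ hi, ← Finset.mul_prod_erase S (fun j => (x j : ℝ)) hi]
  have : ∏ j ∈ S.erase i, (sflip i x j : ℝ) = ∏ j ∈ S.erase i, (x j : ℝ) :=
    Finset.prod_congr rfl fun j hj => by simp [sflip, Finset.ne_of_mem_erase hj]
  rw [this]
  simp [sflip, sneg]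

lemma two_sum {m : ℕ} (f : (Fin m → SignSet) → ℝ) (i : Fin m) (S : Finset (Fin m)) (hi : i ∈ S) :
    2 * ∑ x, f x * ∏ j ∈ S, (x j : ℝ) = ∑ x, (f x - f (sflip i x)) * ∏ j ∈ S, (x j : ℝ) := by
  have h := Equiv.sum_comp (sflip_invol i).toPerm (fun x => f x * ∏ j ∈ S, (x j : ℝ))
  simp only [Function.Involutive.coe_toPerm, chi_flip i S hi] at h
  simp_rw [sub_mul, Finset.sum_sub_distrib]
  simp only [mul_neg, Finset.sum_neg_distrib] at h
  linarith

lemma coef_le {m : ℕ} (f : (Fin m → SignSet) → ℝ) (c : Finset (Fin m) → ℝ)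
    (hmono : ∀ a b : Fin m → SignSet, (∀ i, (a i : ℝ) ≤ (b i : ℝ)) → f a ≤ f b)
    (hc : ∀ x : Fin m → SignSet, f x = ∑ S : Finset (Fin m), c S * ∏ i ∈ S, (x i : ℝ))
    (i : Fin m) (S : Finset (Fin m)) (hi : i ∈ S) : |c S| ≤ c {i} := by
  have h1 := two_sum f i S hi
  have h2 := two_sum f i {i} (Finset.mem_singleton_self i)
  rw [coef_eq f c hc] at h1 h2
  have hchi : ∀ x : Fin m → SignSet, |∏ j ∈ S, (x j : ℝ)| = 1 := by
    intro x
    rw [Finset.abs_prod]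
    exact Finset.prod_eq_one fun j _ => by rcases ss_cases (x j) with h | h <;> simp [h]
  have h3 : |∑ x, (f x - f (sflip i x)) * ∏ j ∈ S, (x j : ℝ)| ≤
      ∑ x, (f x - f (sflip i x)) * ∏ j ∈ {i}, (x j : ℝ) := by
    refine (Finset.abs_sum_le_sum_abs _ _).trans (Finset.sum_le_sum fun x _ => ?_)
    rw [abs_mul, hchi, mul_one, Finset.prod_singleton]
    rcases ss_cases (x i) with h | h
    · have : f x ≤ f (sflip i x) := hmono _ _ fun j => by
        by_cases hj : j = i
        · subst hj; simp [sflip, sneg, h]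
        · simp [sflip, hj]
      rw [h, abs_of_nonpos (by linarith)]; linarith
    · have : f (sflip i x) ≤ f x := hmono _ _ fun j => by
        by_cases hj : j = i
        · subst hj; simp [sflip, sneg, h]
        · simp [sflip, hj]
      rw [h, abs_of_nonneg (by linarith)]; linarith
  rw [← h1, ← h2, abs_mul, abs_mul, abs_of_pos (by norm_num : (0:ℝ) < 2),
    abs_of_pos (by positivity : (0:ℝ) < 2 ^ m)] at h3
  have h4 : (0 : ℝ) < 2 ^ m := by positivity
  nlinarith

/-- For increasing `f¹, f², f³ : {-1,+1}^m → {0,1}`,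
`|∑_{S ≠ ∅} f̂¹_S f̂²_S f̂³_S| ≤ max_i f̂¹_{{i}}`. -/
theorem statement16 (m : ℕ) (hm : 0 < m) (f₁ f₂ f₃ : (Fin m → SignSet) → ℝ)
    (hf₁01 : ∀ x, f₁ x = 0 ∨ f₁ x = 1)
    (hf₂01 : ∀ x, f₂ x = 0 ∨ f₂ x = 1)
    (hf₃01 : ∀ x, f₃ x = 0 ∨ f₃ x = 1)
    (hmono₁ : ∀ a b : Fin m → SignSet, (∀ i, (a i : ℝ) ≤ (b i : ℝ)) → f₁ a ≤ f₁ b)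
    (hmono₂ : ∀ a b : Fin m → SignSet, (∀ i, (a i : ℝ) ≤ (b i : ℝ)) → f₂ a ≤ f₂ b)
    (hmono₃ : ∀ a b : Fin m → SignSet, (∀ i, (a i : ℝ) ≤ (b i : ℝ)) → f₃ a ≤ f₃ b)
    (c₁ c₂ c₃ : Finset (Fin m) → ℝ)
    (hc₁ : ∀ x : Fin m → SignSet, f₁ x = ∑ S : Finset (Fin m), c₁ S * ∏ i ∈ S, (x i : ℝ))
    (hc₂ : ∀ x : Fin m → SignSet, f₂ x = ∑ S : Finset (Fin m), c₂ S * ∏ i ∈ S, (x i : ℝ))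
    (hc₃ : ∀ x : Fin m → SignSet, f₃ x = ∑ S : Finset (Fin m), c₃ S * ∏ i ∈ S, (x i : ℝ)) :
    |∑ S ∈ Finset.univ.filter (fun S : Finset (Fin m) => S ≠ ∅), c₁ S * c₂ S * c₃ S| ≤
      Finset.univ.sup' ⟨⟨0, hm⟩, Finset.mem_univ _⟩ (fun i : Fin m => c₁ {i}) := by
  set M := Finset.univ.sup' ⟨⟨0, hm⟩, Finset.mem_univ _⟩ (fun i : Fin m => c₁ {i}) with hM
  have hle : ∀ i : Fin m, c₁ {i} ≤ M := fun i =>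
    Finset.le_sup' (fun i : Fin m => c₁ {i}) (Finset.mem_univ i)
  have hM0 : 0 ≤ M := (abs_nonneg _).trans
    ((coef_le f₁ c₁ hmono₁ hc₁ ⟨0, hm⟩ {⟨0, hm⟩} (Finset.mem_singleton_self _)).trans (hle _))
  have p2 := parseval_le f₂ c₂ hf₂01 hc₂
  have p3 := parseval_le f₃ c₃ hf₃01 hc₃
  calc |∑ S ∈ Finset.univ.filter (fun S : Finset (Fin m) => S ≠ ∅), c₁ S * c₂ S * c₃ S|
      ≤ ∑ S ∈ Finset.univ.filter (fun S : Finset (Fin m) => S ≠ ∅), |c₁ S * c₂ S * c₃ S| :=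
        Finset.abs_sum_le_sum_abs _ _
    _ ≤ ∑ S ∈ Finset.univ.filter (fun S : Finset (Fin m) => S ≠ ∅),
          M * ((c₂ S ^ 2 + c₃ S ^ 2) / 2) := by
        refine Finset.sum_le_sum fun S hS => ?_
        obtain ⟨i, hi⟩ := Finset.nonempty_iff_ne_empty.mpr (Finset.mem_filter.mp hS).2
        have hb := (coef_le f₁ c₁ hmono₁ hc₁ i S hi).trans (hle i)
        rw [mul_assoc, abs_mul]
        refine mul_le_mul hb ?_ (abs_nonneg _) hM0
        rw [abs_le]
        constructor <;> nlinarith [sq_nonneg (c₂ S - c₃ S), sq_nonneg (c₂ S + c₃ S)]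
    _ ≤ ∑ S, M * ((c₂ S ^ 2 + c₃ S ^ 2) / 2) :=
        Finset.sum_le_sum_of_subset_of_nonneg (Finset.filter_subset _ _)
          fun S _ _ => by positivity
    _ = M * ((∑ S, c₂ S ^ 2 + ∑ S, c₃ S ^ 2) / 2) := by
        rw [← Finset.mul_sum, ← Finset.sum_div, Finset.sum_add_distrib]
    _ ≤ M := by nlinarith
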